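/- arXiv:1610.03037 — 2 statements merged into one kernel-verified Lean document; each statement's English description precedes it below -/
import Mathlib

section
/- (Lévy's inequality for abelian metric groups.) Let (G,·,1,d) be an abelian separable metric group, (Ω,𝒜,μ) a probability space, n, m ∈ ℕ, and X₁,…,Xₙ : Ω → G a symmetric tuple of Borel-measurable random variables. Fix subsets B₁,…,Bₘ ⊆ {1,…,n} such that for all 1 ≤ j ≤ k ≤ m, Bⱼ ∩ Bₖ equals Bⱼ or is empty. For B ⊆ {1,…,n} write X_B := ∏_{b ∈ B} X_b, and set Sₙ := X₁⋯Xₙ. Then for all s, t > 0: μ( max_{1 ≤ k ≤ m} d(1, X_{Bₖ}²) > s + t ) ≤ μ( d(1, Sₙ) > s ) + μ( d(1, Sₙ) > t ). -/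
open MeasureTheory

section InvariantDist

variable {G : Type*} [CommGroup G] [MetricSpace G]

theorem dist_one_mul_le_of_mul_right_invariant
    (hinv : ∀ a b c : G, dist (a * c) (b * c) = dist a b) (a b : G) :
    dist 1 (a * b) ≤ dist 1 a + dist 1 b := by
  have h := dist_triangle 1 b (a * b)
  have h' := hinv 1 a b
  rw [one_mul] at h'
  linarith

theorem dist_one_inv_of_mul_right_invariant
    (hinv : ∀ a b c : G, dist (a * c) (b * c) = dist a b) (a : G) :
    dist 1 a⁻¹ = dist 1 a := by
  have h := hinv 1 a⁻¹ a
  rw [one_mul, inv_mul_cancel] at h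
  rw [← h, dist_comm]

theorem isTopologicalGroup_of_mul_right_invariant
    (hinv : ∀ a b c : G, dist (a * c) (b * c) = dist a b) : IsTopologicalGroup G where
  continuous_mul := by
    refine continuous_iff_continuousAt.2 fun p ↦ tendsto_iff_dist_tendsto_zero.2 ?_
    have hlim : Filter.Tendsto (fun q : G × G ↦ dist q.1 p.1 + dist q.2 p.2) (nhds p) (nhds 0) := by
      have hc : Continuous fun q : G × G ↦ dist q.1 p.1 + dist q.2 p.2 := by fun_prop
      simpa using hc.tendsto p
    refine squeeze_zero (fun _ ↦ dist_nonneg) (fun q ↦ ?_) hlim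
    calc dist (q.1 * q.2) (p.1 * p.2)
        ≤ dist (q.1 * q.2) (p.1 * q.2) + dist (p.1 * q.2) (p.1 * p.2) := dist_triangle _ _ _
      _ = dist q.1 p.1 + dist q.2 p.2 := by
        rw [hinv, mul_comm p.1 q.2, mul_comm p.1 p.2, hinv]
  continuous_inv := by
    refine Isometry.continuous (Isometry.of_dist_eq fun a b ↦ ?_)
    have h := hinv a⁻¹ b⁻¹ (a * b)
    rwa [inv_mul_cancel_left, mul_comm a b, inv_mul_cancel_left, dist_comm, eq_comm] at h

end InvariantDist

/-- Invert the coordinates outside `s`. -/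
def invOutside {ι G : Type*} [DecidableEq ι] [Group G] (s : Finset ι) (x : ι → G) : ι → G :=
  fun i ↦ x i ^ (if decide (i ∈ s) then (1 : ℤ) else -1)

section InvOutside

variable {ι G : Type*} [DecidableEq ι] [CommGroup G]

theorem prod_invOutside_of_subset {s r : Finset ι} (h : r ⊆ s) (x : ι → G) :
    ∏ i ∈ r, invOutside s x i = ∏ i ∈ r, x i :=
  Finset.prod_congr rfl fun i hi ↦ by simp [invOutside, h hi]

theorem prod_invOutside_of_disjoint {s r : Finset ι} (h : Disjoint r s) (x : ι → G) :
    ∏ i ∈ r, invOutside s x i = (∏ i ∈ r, x i)⁻¹ := by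
  rw [← Finset.prod_inv_distrib]
  exact Finset.prod_congr rfl fun i hi ↦ by simp [invOutside, Finset.disjoint_left.1 h hi]

theorem prod_mul_prod_invOutside [Fintype ι] (s : Finset ι) (x : ι → G) :
    (∏ i, x i) * ∏ i, invOutside s x i = (∏ i ∈ s, x i) ^ 2 := by
  rw [← Finset.prod_mul_prod_compl s x, ← Finset.prod_mul_prod_compl s (invOutside s x),
    prod_invOutside_of_subset subset_rfl, prod_invOutside_of_disjoint disjoint_compl_left, sq,
    mul_mul_mul_comm, mul_inv_cancel, mul_one]

end InvOutside

/-- Lévy's inequality for abelian separable metric groups. `(X i)` is a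
symmetric tuple of Borel random variables (any choice of signs leaves the joint
distribution unchanged), `B k ⊆ Fin n` are nested-or-disjoint subsets, `X_B = ∏_{b∈B} X b`,
`Sₙ = ∏ i X i`. Then
`μ(max_k d(1, X_{B k}²) > s+t) ≤ μ(d(1,Sₙ) > s) + μ(d(1,Sₙ) > t)`,
where `max_k (⬝) > s+t` is expressed as `∃ k, (⬝) > s+t`. -/
theorem levy_inequality
    (G : Type*) [CommGroup G] [MetricSpace G] [TopologicalSpace.SeparableSpace G]
    [MeasurableSpace G] [BorelSpace G]
    (hinv : ∀ a b c : G, dist (a * c) (b * c) = dist a b)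
    (Ω : Type*) [MeasurableSpace Ω] (μ : Measure Ω) [IsProbabilityMeasure μ]
    (n m : ℕ) (X : Fin n → Ω → G) (hX : ∀ i, Measurable (X i))
    (hsymm : ∀ ε : Fin n → Bool,
      Measure.map (fun ω => fun i => (X i ω) ^ (if ε i then (1 : ℤ) else -1)) μ
        = Measure.map (fun ω => fun i => X i ω) μ)
    (B : Fin m → Finset (Fin n))
    (hB : ∀ j k : Fin m, j ≤ k → (B j ∩ B k = B j ∨ B j ∩ B k = ∅))
    (s t : ℝ) (hs : 0 < s) (ht : 0 < t) :
    μ {ω | ∃ k : Fin m, s + t < dist (1 : G) ((∏ b ∈ B k, X b ω) ^ 2)}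
      ≤ μ {ω | s < dist (1 : G) (∏ i, X i ω)} + μ {ω | t < dist (1 : G) (∏ i, X i ω)} := by
  classical
  have := isTopologicalGroup_of_mul_right_invariant hinv
  have := UniformSpace.secondCountable_of_separable G
  -- `A k`: the index `k` is the first one at which the threshold is exceeded.
  let P : Fin m → (Fin n → G) → Prop := fun k x ↦ s + t < dist (1 : G) ((∏ b ∈ B k, x b) ^ 2)
  let A : Fin m → Set (Fin n → G) := fun k ↦ {x | P k x ∧ ∀ j < k, ¬ P j x}
  let D : ℝ → Set (Fin n → G) := fun r ↦ {x | r < dist (1 : G) (∏ i, x i)}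
  let Y : Ω → Fin n → G := fun ω i ↦ X i ω
  have hY : Measurable Y := measurable_pi_lambda _ hX
  have hP : ∀ k, MeasurableSet {x | P k x} := fun k ↦
    (isOpen_lt continuous_const (by fun_prop)).measurableSet
  have hA : ∀ k, MeasurableSet (A k) := by
    intro k
    have hAk : A k = {x | P k x} ∩ ⋂ j, ⋂ (_ : j < k), {x | P j x}ᶜ := by
      ext x; simp [A]
    rw [hAk]
    exact (hP k).inter (.iInter fun j ↦ .iInter fun _ ↦ (hP j).compl)
  have hD : ∀ r, MeasurableSet (D r) := fun r ↦
    (isOpen_lt continuous_const (by fun_prop)).measurableSet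
  have hflip : ∀ k, Measurable (invOutside (G := G) (B k)) := by
    intro k
    refine measurable_pi_lambda _ fun i ↦ ?_
    unfold invOutside
    split_ifs <;> simpa using measurable_pi_apply i
  have hPflip : ∀ j k, j ≤ k → ∀ x, P j (invOutside (B k) x) ↔ P j x := by
    intro j k hjk x
    rcases hB j k hjk with h | h
    · simp only [P, prod_invOutside_of_subset (Finset.inter_eq_left.1 h)]
    · simp only [P, prod_invOutside_of_disjoint (Finset.disjoint_iff_inter_eq_empty.2 h), inv_pow,
        dist_one_inv_of_mul_right_invariant hinv]
  have hAflip : ∀ k x, invOutside (B k) x ∈ A k ↔ x ∈ A k := by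
    intro k x
    exact and_congr (hPflip k k le_rfl x)
      (forall₂_congr fun j hj ↦ not_congr (hPflip j k hj.le x))
  have hsub : ∀ k, A k ⊆ (A k ∩ D s) ∪ invOutside (B k) ⁻¹' (A k ∩ D t) := by
    intro k x hx
    have hlt : s + t < dist 1 ((∏ i, x i) * ∏ i, invOutside (B k) x i) := by
      rw [prod_mul_prod_invOutside]
      exact hx.1
    have hle := dist_one_mul_le_of_mul_right_invariant hinv (∏ i, x i)
      (∏ i, invOutside (B k) x i)
    by_cases h : s < dist 1 (∏ i, x i)
    · exact Or.inl ⟨hx, h⟩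
    · refine Or.inr ⟨(hAflip k x).2 hx, ?_⟩
      change t < dist 1 (∏ i, invOutside (B k) x i)
      linarith
  have hpres : ∀ k, (μ.map Y).map (invOutside (B k)) = μ.map Y := by
    intro k
    rw [Measure.map_map (hflip k) hY]
    exact hsymm fun i ↦ decide (i ∈ B k)
  have hAk : ∀ k, μ.map Y (A k) ≤ μ.map Y (A k ∩ D s) + μ.map Y (A k ∩ D t) := by
    intro k
    refine (measure_mono (hsub k)).trans ((measure_union_le _ _).trans_eq ?_)
    rw [← Measure.map_apply (hflip k) ((hA k).inter (hD t)), hpres k]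
  have hdisj : Pairwise (Function.onFun Disjoint A) := by
    intro j k hjk
    refine Set.disjoint_left.2 fun x hj hk ↦ ?_
    rcases lt_or_gt_of_ne hjk with h | h
    · exact hk.2 j h hj.1
    · exact hj.2 k h hk.1
  have hsum : ∀ r, ∑ k, μ.map Y (A k ∩ D r) ≤ μ.map Y (D r) := by
    intro r
    rw [← tsum_fintype (L := .unconditional _), ← measure_iUnion
      (fun j k hjk ↦ (hdisj hjk).mono Set.inter_subset_left Set.inter_subset_left)
      fun k ↦ (hA k).inter (hD r)]
    exact measure_mono (Set.iUnion_subset fun k ↦ Set.inter_subset_right)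
  have hcover : {x | ∃ k, P k x} ⊆ ⋃ k, A k := by
    rintro x hx
    obtain ⟨k, hk, hmin⟩ := WellFounded.has_min (wellFounded_lt (α := Fin m)) {k | P k x} hx
    exact Set.mem_iUnion.2 ⟨k, hk, fun j hjk hj ↦ hmin j hj hjk⟩
  calc μ {ω | ∃ k, P k (Y ω)}
      ≤ μ (Y ⁻¹' ⋃ k, A k) := measure_mono (Set.preimage_mono (f := Y) hcover)
    _ = μ.map Y (⋃ k, A k) := (Measure.map_apply hY (.iUnion hA)).symm
    _ ≤ ∑ k, μ.map Y (A k) := measure_iUnion_fintype_le _ _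
    _ ≤ ∑ k, (μ.map Y (A k ∩ D s) + μ.map Y (A k ∩ D t)) := Finset.sum_le_sum fun k _ ↦ hAk k
    _ ≤ μ.map Y (D s) + μ.map Y (D t) := by
      rw [Finset.sum_add_distrib]
      exact add_le_add (hsum s) (hsum t)
    _ = μ {ω | s < dist (1 : G) (∏ i, X i ω)} + μ {ω | t < dist (1 : G) (∏ i, X i ω)} := by
      rw [Measure.map_apply hY (hD s), Measure.map_apply hY (hD t)]
      rfl
end

section
/- Let (G,·,1,d) be a separable abelian metric group, n ∈ ℕ, x₁,…,xₙ ∈ G, and let ε be uniformly distributed on {−1,1}ⁿ. Write Sₙ(ε) := ∏ₖ xₖ^{εₖ} and Sₙ^{2^{l}}(ε) := ∏ₖ xₖ^{2^{l}·εₖ}. Then for every l ∈ ℕ and every r > 0: ℙ( d(1, Sₙ^{2^{l}}) > 4^{l}·r ) ≤ 4^{2^{l}−1} · ℙ( d(1, Sₙ) > r )^{2^{l}}. -/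
section SignReflection

open Finset

variable {n : ℕ}

/-- Flip the signs of `ε` outside `s`. -/
def flipOutside (s : Finset (Fin n)) (ε : Fin n → Bool) : Fin n → Bool :=
  fun j => if j ∈ s then ε j else !ε j

theorem flipOutside_involutive (s : Finset (Fin n)) : Function.Involutive (flipOutside s) := by
  intro ε
  funext j
  by_cases h : j ∈ s <;> simp [flipOutside, h]

/-- Exchange the signs with index greater than `k` between two sign vectors, each block being
multiplied by the product of the two signs at `k`. -/
def swapAfter (k : Fin n) (p : (Fin n → Bool) × (Fin n → Bool)) :
    (Fin n → Bool) × (Fin n → Bool) :=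
  (fun j => if j ≤ k then p.1 j else xor (p.2 j) (xor (p.1 k) (p.2 k)),
   fun j => if j ≤ k then p.2 j else xor (p.1 j) (xor (p.1 k) (p.2 k)))

theorem swapAfter_involutive (k : Fin n) : Function.Involutive (swapAfter k) := by
  rintro ⟨ε, δ⟩
  ext j <;> by_cases h : j ≤ k <;> simp [swapAfter, h]

/-- An event depending on the signs up to index `k` is independent of an event that depends on
the signs from index `k` on and is invariant under a global change of sign. -/
theorem card_and_mul_card_eq (k : Fin n) (A B : (Fin n → Bool) → Prop)
    [DecidablePred A] [DecidablePred B]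
    (hA : ∀ ε δ : Fin n → Bool, (∀ j ≤ k, ε j = δ j) → (A ε ↔ A δ))
    (hB : ∀ ε δ : Fin n → Bool, (∀ j, k ≤ j → ε j = δ j) → (B ε ↔ B δ))
    (hflip : ∀ ε : Fin n → Bool, B (fun j => !ε j) ↔ B ε) :
    #{ε | A ε ∧ B ε} * 2 ^ n = #{ε | A ε} * #{ε | B ε} := by
  have hcard : (2 : ℕ) ^ n = #(univ : Finset (Fin n → Bool)) := by simp
  rw [hcard, ← card_product, ← card_product]
  have hBswap : ∀ ε δ : Fin n → Bool, B (swapAfter k (ε, δ)).1 ↔ B δ := by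
    intro ε δ
    by_cases h : ε k = δ k
    · refine hB _ _ fun j hj => ?_
      by_cases hjk : j ≤ k
      · obtain rfl := le_antisymm hjk hj
        simp [swapAfter, h]
      · simp [swapAfter, hjk, h]
    · rw [← hflip δ]
      have h' : ε k = !δ k := by cases hε : ε k <;> cases hδ : δ k <;> simp_all
      refine hB _ _ fun j hj => ?_
      by_cases hjk : j ≤ k
      · obtain rfl := le_antisymm hjk hj
        simp [swapAfter, h']
      · simp [swapAfter, hjk, h']
  have hAswap : ∀ ε δ : Fin n → Bool, A (swapAfter k (ε, δ)).1 ↔ A ε := by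
    intro ε δ
    refine hA _ _ fun j hj => ?_
    simp [swapAfter, hj]
  symm
  refine card_bij' (fun p _ => swapAfter k p) (fun p _ => swapAfter k p) ?_ ?_
    (fun p _ => swapAfter_involutive k p) (fun p _ => swapAfter_involutive k p)
  · rintro ⟨ε, δ⟩ h
    simpa [hAswap, hBswap] using h
  · rintro p h
    obtain ⟨q, rfl⟩ := (swapAfter_involutive k).surjective p
    rw [swapAfter_involutive k q]
    obtain ⟨ε, δ⟩ := q
    simpa [hAswap, hBswap] using h

end SignReflection

section LevyInequality

open Finset

variable {G : Type*} [CommGroup G] {n : ℕ}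

/-- The product of `x k ^ (± 1)` over `k ∈ s`, with signs given by `ε`. -/
def signedProd (x : Fin n → G) (s : Finset (Fin n)) (ε : Fin n → Bool) : G :=
  ∏ k ∈ s, x k ^ (if ε k then (1 : ℤ) else -1)

theorem signedProd_congr (x : Fin n → G) (s : Finset (Fin n)) {ε δ : Fin n → Bool}
    (h : ∀ j ∈ s, ε j = δ j) : signedProd x s ε = signedProd x s δ :=
  prod_congr rfl fun j hj => by rw [h j hj]

theorem signedProd_not (x : Fin n → G) (s : Finset (Fin n)) (ε : Fin n → Bool) :
    signedProd x s (fun j => !ε j) = (signedProd x s ε)⁻¹ := by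
  rw [signedProd, signedProd, ← prod_inv_distrib]
  refine prod_congr rfl fun j _ => ?_
  cases ε j <;> simp

theorem signedProd_mul_compl (x : Fin n → G) (s : Finset (Fin n)) (ε : Fin n → Bool) :
    signedProd x s ε * signedProd x sᶜ ε = signedProd x univ ε :=
  prod_mul_prod_compl s _

theorem signedProd_sq (x : Fin n → G) (s : Finset (Fin n)) (ε : Fin n → Bool) :
    signedProd x s ε ^ 2 = signedProd x univ ε * signedProd x univ (flipOutside s ε) := by
  rw [← signedProd_mul_compl x s ε, ← signedProd_mul_compl x s (flipOutside s ε),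
    signedProd_congr x s (ε := flipOutside s ε) (δ := ε) (by simp +contextual [flipOutside]),
    signedProd_congr x sᶜ (ε := flipOutside s ε) (δ := fun j => !ε j)
      (by simp +contextual [flipOutside]), signedProd_not]
  rw [sq, mul_mul_mul_comm, mul_inv_cancel, mul_one]

theorem signedProd_pow (x : Fin n → G) (s : Finset (Fin n)) (m : ℕ) (ε : Fin n → Bool) :
    signedProd (fun k => x k ^ m) s ε = signedProd x s ε ^ m := by
  simp only [signedProd, ← prod_pow]
  refine prod_congr rfl fun k _ => ?_
  rw [← zpow_natCast, ← zpow_natCast, zpow_comm]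

variable [MetricSpace G]

theorem dist_one_mul_le (hinv : ∀ a b c : G, dist (a * c) (b * c) = dist a b) (g h : G) :
    dist 1 (g * h) ≤ dist 1 g + dist 1 h := by
  have h₁ := hinv 1 g h
  have h₂ := dist_triangle 1 h (g * h)
  rw [one_mul] at h₁
  linarith

theorem dist_one_inv (hinv : ∀ a b c : G, dist (a * c) (b * c) = dist a b) (g : G) :
    dist 1 g⁻¹ = dist 1 g := by
  rw [← hinv 1 g⁻¹ g, one_mul, inv_mul_cancel, dist_comm]

open Classical in
/-- Reflection principle: on an event invariant under flipping the signs outside `s`, the square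
of the product over `s` is controlled by the full product. -/
theorem card_signedProd_sq_le (hinv : ∀ a b c : G, dist (a * c) (b * c) = dist a b)
    (x : Fin n → G) (s : Finset (Fin n)) (r : ℝ) (P : (Fin n → Bool) → Prop)
    (hP : ∀ ε, P (flipOutside s ε) ↔ P ε) :
    #{ε | P ε ∧ 2 * r < dist 1 (signedProd x s ε ^ 2)} ≤
      2 * #{ε | P ε ∧ r < dist 1 (signedProd x univ ε)} := by
  have hreflect : #{ε | P ε ∧ r < dist 1 (signedProd x univ (flipOutside s ε))} =
      #{ε | P ε ∧ r < dist 1 (signedProd x univ ε)} := by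
    refine card_bij' (fun ε _ => flipOutside s ε) (fun ε _ => flipOutside s ε) ?_ ?_
      (fun ε _ => flipOutside_involutive s ε) (fun ε _ => flipOutside_involutive s ε)
    · intro ε h
      simpa [hP] using h
    · intro ε h
      simpa [hP, flipOutside_involutive s ε] using h
  rw [two_mul (#_)]
  nth_rewrite 2 [← hreflect]
  refine (card_le_card fun ε h => ?_).trans (card_union_le _ _)
  simp only [mem_filter, mem_univ, true_and, mem_union] at h ⊢
  rw [signedProd_sq] at h
  have := dist_one_mul_le hinv (signedProd x univ ε) (signedProd x univ (flipOutside s ε))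
  by_contra! hcon
  linarith [hcon.1 h.1, hcon.2 h.1]

/-- The squared partial products first leave the ball of radius `2 * r` around `1` at index `k`. -/
def FirstExit (x : Fin n → G) (r : ℝ) (k : Fin n) (ε : Fin n → Bool) : Prop :=
  (∀ i ≤ k, dist 1 (signedProd x (Iio i) ε ^ 2) ≤ 2 * r) ∧
    2 * r < dist 1 (signedProd x (Iic k) ε ^ 2)

theorem firstExit_congr (x : Fin n → G) (r : ℝ) (k : Fin n) {ε δ : Fin n → Bool}
    (h : ∀ j ≤ k, ε j = δ j) : FirstExit x r k ε ↔ FirstExit x r k δ := by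
  refine and_congr (forall₂_congr fun i hi => ?_) ?_
  · rw [signedProd_congr x (Iio i) fun j hj => h j ((mem_Iio.1 hj).le.trans hi)]
  · rw [signedProd_congr x (Iic k) fun j hj => h j (mem_Iic.1 hj)]

theorem FirstExit.le {x : Fin n → G} {r : ℝ} {i k : Fin n} {ε : Fin n → Bool}
    (hi : FirstExit x r i ε) (hk : FirstExit x r k ε) : k ≤ i := by
  by_contra! hik
  have hk' : i.val + 1 < n := by omega
  have hset : Iio (⟨i.val + 1, hk'⟩ : Fin n) = Iic i := by
    ext j
    simp only [mem_Iio, mem_Iic, Fin.lt_def, Fin.le_def]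
    omega
  have := hk.1 ⟨i.val + 1, hk'⟩ (by simp only [Fin.lt_def, Fin.le_def] at hik ⊢; omega)
  rw [hset] at this
  exact this.not_gt hi.2

theorem FirstExit.unique {x : Fin n → G} {r : ℝ} {i k : Fin n} {ε : Fin n → Bool}
    (hi : FirstExit x r i ε) (hk : FirstExit x r k ε) : i = k :=
  le_antisymm (hk.le hi) (hi.le hk)

theorem exists_firstExit (x : Fin n → G) {r : ℝ} (hr : 0 < r) {ε : Fin n → Bool}
    (h : 2 * r < dist 1 (signedProd x univ ε ^ 2)) : ∃ k, FirstExit x r k ε := by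
  classical
  let E (m : ℕ) : Prop := 2 * r < dist 1 (signedProd x {j | j.val < m} ε ^ 2)
  have hE : ∃ m, E m := ⟨n, by simpa [E] using h⟩
  have hn : Nat.find hE ≤ n := Nat.find_min' hE (by simpa [E] using h)
  have hpos : Nat.find hE ≠ 0 := by
    intro h0
    have := Nat.find_spec hE
    rw [h0] at this
    simp only [E, Nat.not_lt_zero, filter_false, signedProd, prod_empty, one_pow,
      dist_self] at this
    linarith
  obtain ⟨m, hm⟩ := Nat.exists_eq_succ_of_ne_zero hpos
  refine ⟨⟨m, by omega⟩, fun i hi => ?_, ?_⟩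
  · have := Nat.find_min hE (m := i.val) (by simp only [Fin.le_def] at hi; omega)
    have hset : Iio i = ({j | j.val < i.val} : Finset (Fin n)) := by
      ext j
      simp
    rw [hset]
    exact not_lt.1 this
  · have hset : Iic (⟨m, by omega⟩ : Fin n) = ({j | j.val < m + 1} : Finset (Fin n)) := by
      ext j
      simp [Fin.le_def]
    rw [hset]
    simpa [hm, E] using Nat.find_spec hE

open Classical in
/-- Squaring the tail of a Rademacher product: the counting form of
`ℙ(d(1, S²) > 4r) ≤ 4 ℙ(d(1, S) > r)²`. -/
theorem card_signedProd_sq_mul_le (hinv : ∀ a b c : G, dist (a * c) (b * c) = dist a b)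
    (x : Fin n → G) {r : ℝ} (hr : 0 < r) :
    #{ε | 4 * r < dist 1 (signedProd x univ ε ^ 2)} * 2 ^ n ≤
      4 * #{ε | r < dist 1 (signedProd x univ ε)} ^ 2 := by
  set Q : (Fin n → Bool) → Prop := fun ε => r < dist 1 (signedProd x univ ε) with hQ
  let B (k : Fin n) (ε : Fin n → Bool) : Prop := 2 * r < dist 1 (signedProd x (Ici k) ε ^ 2)
  have hcover : #{ε | 4 * r < dist 1 (signedProd x univ ε ^ 2)} ≤
      ∑ k, #{ε | FirstExit x r k ε ∧ B k ε} := by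
    refine (card_le_card fun ε h => ?_).trans card_biUnion_le
    simp only [mem_filter, mem_univ, true_and, mem_biUnion] at h ⊢
    obtain ⟨k, hk⟩ := exists_firstExit x hr (ε := ε) (by linarith)
    refine ⟨k, hk, ?_⟩
    have hcompl : (Iio k)ᶜ = Ici k := by
      ext j
      simp
    rw [← signedProd_mul_compl x (Iio k), hcompl, mul_pow] at h
    have := dist_one_mul_le hinv (signedProd x (Iio k) ε ^ 2) (signedProd x (Ici k) ε ^ 2)
    simp only [B]
    linarith [hk.1 k le_rfl]
  have hindep (k : Fin n) : #{ε | FirstExit x r k ε ∧ B k ε} * 2 ^ n =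
      #{ε | FirstExit x r k ε} * #{ε | B k ε} := by
    refine card_and_mul_card_eq k _ _ (fun ε δ h => firstExit_congr x r k h) (fun ε δ h => ?_)
      fun ε => ?_
    · simp only [B]
      rw [signedProd_congr x (Ici k) fun j hj => h j (mem_Ici.1 hj)]
    · simp only [B]
      rw [signedProd_not, inv_pow, dist_one_inv hinv]
  have hB (k : Fin n) : #{ε | B k ε} ≤ 2 * #{ε | Q ε} := by
    simpa using card_signedProd_sq_le hinv x (Ici k) r (fun _ => True) (by simp)
  have hA (k : Fin n) : #{ε | FirstExit x r k ε} ≤ 2 * #{ε | FirstExit x r k ε ∧ Q ε} := by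
    refine le_trans (card_le_card fun ε h => ?_) (card_signedProd_sq_le hinv x (Iic k) r _
      fun ε => firstExit_congr x r k fun j hj => by simp [flipOutside, hj])
    simp only [mem_filter, mem_univ, true_and] at h ⊢
    exact ⟨h, h.2⟩
  have hdisj : ∑ k, #{ε | FirstExit x r k ε ∧ Q ε} ≤ #{ε | Q ε} := by
    rw [← card_biUnion]
    · refine card_le_card fun ε h => ?_
      simp only [mem_filter, mem_univ, true_and, mem_biUnion] at h ⊢
      exact h.choose_spec.2
    · intro i _ k _ hik
      refine disjoint_left.2 fun ε hi hk => hik ?_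
      simp only [mem_filter, mem_univ, true_and] at hi hk
      exact hi.1.unique hk.1
  calc #{ε | 4 * r < dist 1 (signedProd x univ ε ^ 2)} * 2 ^ n
      ≤ (∑ k, #{ε | FirstExit x r k ε ∧ B k ε}) * 2 ^ n := by gcongr
    _ = ∑ k, #{ε | FirstExit x r k ε} * #{ε | B k ε} := by
        rw [sum_mul]
        exact sum_congr rfl fun k _ => hindep k
    _ ≤ ∑ k, (2 * #{ε | FirstExit x r k ε ∧ Q ε}) * (2 * #{ε | Q ε}) :=
        sum_le_sum fun k _ => Nat.mul_le_mul (hA k) (hB k)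
    _ = 4 * ((∑ k, #{ε | FirstExit x r k ε ∧ Q ε}) * #{ε | Q ε}) := by
        rw [sum_mul, mul_sum]
        exact sum_congr rfl fun k _ => by ring
    _ ≤ 4 * (#{ε | Q ε} * #{ε | Q ε}) := by gcongr
    _ = 4 * #{ε | Q ε} ^ 2 := by rw [sq]

/-- The probability that a Rademacher product has distance more than `r` from `1`. -/
noncomputable def tailProb (x : Fin n → G) (r : ℝ) : ℝ :=
  (∑ ε : Fin n → Bool, if r < dist 1 (signedProd x univ ε) then (1 : ℝ) else 0) / 2 ^ n

theorem tailProb_nonneg (x : Fin n → G) (r : ℝ) : 0 ≤ tailProb x r :=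
  div_nonneg (sum_nonneg fun ε _ => by split_ifs <;> norm_num) (by positivity)

theorem tailProb_sq_le (hinv : ∀ a b c : G, dist (a * c) (b * c) = dist a b)
    (x : Fin n → G) {r : ℝ} (hr : 0 < r) :
    tailProb (fun k => x k ^ 2) (4 * r) ≤ 4 * tailProb x r ^ 2 := by
  classical
  have h := card_signedProd_sq_mul_le hinv x hr
  simp only [tailProb, signedProd_pow, sum_boole]
  rw [div_pow, ← mul_div_assoc, div_le_div_iff₀ (by positivity) (by positivity), sq (2 ^ n : ℝ),
    ← mul_assoc]
  exact mul_le_mul_of_nonneg_right (by exact_mod_cast h) (by positivity)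

theorem tailProb_two_pow_le (hinv : ∀ a b c : G, dist (a * c) (b * c) = dist a b)
    (x : Fin n → G) {r : ℝ} (hr : 0 < r) (l : ℕ) :
    tailProb (fun k => x k ^ 2 ^ l) (4 ^ l * r) ≤ 4 ^ (2 ^ l - 1) * tailProb x r ^ 2 ^ l := by
  induction l with
  | zero => simp
  | succ l ih =>
    have hsq := tailProb_sq_le hinv (fun k => x k ^ 2 ^ l) (r := 4 ^ l * r) (by positivity)
    simp only [← pow_mul, ← pow_succ, ← mul_assoc, ← pow_succ'] at hsq
    have hexp : 2 ^ (l + 1) - 1 = (2 ^ l - 1) * 2 + 1 := by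
      have := Nat.one_le_two_pow (n := l)
      omega
    calc tailProb (fun k => x k ^ 2 ^ (l + 1)) (4 ^ (l + 1) * r)
        ≤ 4 * tailProb (fun k => x k ^ 2 ^ l) (4 ^ l * r) ^ 2 := hsq
      _ ≤ 4 * (4 ^ (2 ^ l - 1) * tailProb x r ^ 2 ^ l) ^ 2 := by
          gcongr
          exact tailProb_nonneg _ _
      _ = 4 ^ (2 ^ (l + 1) - 1) * tailProb x r ^ 2 ^ (l + 1) := by
          rw [hexp, pow_succ 2 l, mul_pow, ← pow_mul, ← pow_mul, pow_succ 4]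
          ring

end LevyInequality


/-- For a separable abelian metric group `G`, Rademacher signs uniform on
`{−1,1}ⁿ`, `Sₙ(ε) = ∏ₖ xₖ^{εₖ}` and `Sₙ^{2^l}(ε) = ∏ₖ xₖ^{2^l·εₖ}`: for every `l ≥ 1`
(the paper's `l ∈ ℕ`) and `r > 0`,
`ℙ(d(1, Sₙ^{2^l}) > 4^l·r) ≤ 4^{2^l − 1} · ℙ(d(1, Sₙ) > r)^{2^l}`. -/
theorem iterated_levy_bound
    (G : Type*) [CommGroup G] [MetricSpace G] [TopologicalSpace.SeparableSpace G]
    (hinv : ∀ a b c : G, dist (a * c) (b * c) = dist a b)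
    (n : ℕ) (x : Fin n → G) (l : ℕ) (hl : 1 ≤ l) (r : ℝ) (hr : 0 < r) :
    (∑ ε : Fin n → Bool,
        if (4 : ℝ) ^ l * r < dist (1 : G) (∏ k, x k ^ ((2 : ℤ) ^ l * (if ε k then (1 : ℤ) else -1)))
        then (1 : ℝ) else 0) / 2 ^ n
      ≤ 4 ^ (2 ^ l - 1) *
        ((∑ ε : Fin n → Bool,
          if r < dist (1 : G) (∏ k, x k ^ (if ε k then (1 : ℤ) else -1))
          then (1 : ℝ) else 0) / 2 ^ n) ^ (2 ^ l) := by
  have h := tailProb_two_pow_le hinv x hr l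
  unfold tailProb signedProd at h
  have hpow (k : Fin n) (e : ℤ) : x k ^ ((2 : ℤ) ^ l * e) = (x k ^ 2 ^ l) ^ e := by
    rw [zpow_mul]
    norm_cast
  simpa only [hpow] using h
end
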